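/- (Entropic indistinguishability implies strong entropic security.) Let E be a CPTP map from d_A × d_A matrices to d' × d' matrices, let t be a real number and ε ≥ 0, and suppose there exists a density matrix Ω on ℂ^{d'} such that for every density matrix ρ' on ℂ^{d_A} ⊗ ℂ^{d_E} for which there exists a density matrix σ' on ℂ^{d_E} with ρ' ≤ 2^{−(t−1)}(I_{d_A} ⊗ σ'), one has ‖ (E ⊗ id)(ρ') − Ω ⊗ tr_A ρ' ‖₁ ≤ ε/2. Then for every density matrix ρ on ℂ^{d_A} ⊗ ℂ^{d_E} for which there exists a density matrix σ on ℂ^{d_E} with ρ ≤ 2^{−t}(I_{d_A} ⊗ σ), every finite interpretation {(p_i, σ_i)}_{i∈I} of ρ (i.e., p_i ≥ 0, ∑_i p_i = 1, each σ_i a density matrix on ℂ^{d_A} ⊗ ℂ^{d_E}, and ∑_i p_i σ_i = ρ), every POVM (A_j)_{j∈J} on ℂ^{d'} ⊗ ℂ^{d_E}, and every function f : I → J, one has | ∑_i p_i tr[A_{f(i)} (E ⊗ id)(σ_i)] − ∑_i p_i tr[A_{f(i)} (E(tr_E ρ) ⊗ tr_A σ_i)] | ≤ ε. -/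

import Mathlib

open Matrix Kronecker ComplexOrder

noncomputable section

/-- A density matrix: positive semidefinite with trace 1. -/
def IsDensity {d : Type*} [Fintype d] (ρ : Matrix d d ℂ) : Prop :=
  ρ.PosSemidef ∧ ρ.trace = 1

/-- Loewner order: `A ≤ B` iff `B - A` is positive semidefinite. -/
def LoewnerLE {d : Type*} [Fintype d] (A B : Matrix d d ℂ) : Prop :=
  (B - A).PosSemidef

/-- Partial trace over the first (A) system. -/
def ptraceA {A E : Type*} [Fintype A] (M : Matrix (A × E) (A × E) ℂ) : Matrix E E ℂ :=
  Matrix.of fun e e' => ∑ a, M (a, e) (a, e')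

/-- Partial trace over the second (E) system. -/
def ptraceE {A E : Type*} [Fintype E] (M : Matrix (A × E) (A × E) ℂ) : Matrix A A ℂ :=
  Matrix.of fun a a' => ∑ e, M (a, e) (a', e)

/-- The positive semidefinite square root of a positive semidefinite matrix
(the definition of the older Mathlib, which is gone from the current one). -/
def Matrix.PosSemidef.sqrt {n 𝕜 : Type*} [Fintype n] [RCLike 𝕜] [DecidableEq n]
    {A : Matrix n n 𝕜} (hA : A.PosSemidef) : Matrix n n 𝕜 :=
  hA.1.eigenvectorUnitary.1 * diagonal ((↑) ∘ Real.sqrt ∘ hA.1.eigenvalues) *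
  (star hA.1.eigenvectorUnitary : Matrix n n 𝕜)

/-- Trace norm of a complex matrix: `tr √(MᴴM)`. -/
def traceNorm {d : Type*} [Fintype d] [DecidableEq d] (M : Matrix d d ℂ) : ℝ :=
  ((Matrix.posSemidef_conjTranspose_mul_self M).sqrt).trace.re

/-! ### sign averaging -/
section Abs
set_option linter.unusedSectionVars false
variable {J : Type*} [Fintype J] [DecidableEq J]

def sg (s : J → ℤˣ) : J → ℝ := fun j => ((s j : ℤ) : ℝ)

lemma sg_cases (s : J → ℤˣ) (j : J) : sg s j = 1 ∨ sg s j = -1 := by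
  rcases Int.units_eq_one_or (s j) with h | h <;> simp [sg, h]

lemma sg_mul (g s : J → ℤˣ) (j : J) : sg (g * s) j = sg g j * sg s j := by
  simp [sg]

lemma sg_sum (j k : J) :
    ∑ s : J → ℤˣ, sg s j * sg s k = if j = k then (Fintype.card (J → ℤˣ) : ℝ) else 0 := by
  split_ifs with h
  · subst h
    have : ∀ s : J → ℤˣ, sg s j * sg s j = 1 := by
      intro s; rcases sg_cases s j with h | h <;> simp [h]
    simp [this]
  · have h1 := Equiv.sum_comp (Equiv.mulLeft (Pi.mulSingle j (-1) : J → ℤˣ))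
      (fun s => sg s j * sg s k)
    simp only [Equiv.coe_mulLeft, sg_mul] at h1
    have h2 : sg (Pi.mulSingle j (-1) : J → ℤˣ) j = -1 := by simp [sg]
    have h3 : sg (Pi.mulSingle j (-1) : J → ℤˣ) k = 1 := by
      simp [sg, Pi.mulSingle_eq_of_ne (Ne.symm h)]
    simp only [h2, h3, one_mul, neg_mul, Finset.sum_neg_distrib] at h1
    linarith

lemma sg_avg (B : (J → ℝ) →ₗ[ℝ] (J → ℝ) →ₗ[ℝ] ℝ) (d : J → ℝ) :
    ∑ s : J → ℤˣ, B (d * sg s) (d * sg s)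
      = (Fintype.card (J → ℤˣ) : ℝ) * ∑ j, d j ^ 2 * B (Pi.single j 1) (Pi.single j 1) := by
  have h : ∀ s : J → ℤˣ, B (d * sg s) (d * sg s)
      = ∑ j, ∑ k, (sg s j * sg s k) * (d j * d k * B (Pi.single j 1) (Pi.single k 1)) := by
    intro s
    have e : d * sg s = ∑ j, (d j * sg s j) • (Pi.single j 1 : J → ℝ) := by
      conv_lhs => rw [pi_eq_sum_univ' (d * sg s)]
      refine Finset.sum_congr rfl fun j _ => ?_
      ext k
      simp [Pi.single_apply, eq_comm]
    rw [e]
    simp only [map_sum, LinearMap.sum_apply, map_smul, LinearMap.smul_apply, smul_eq_mul]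
    simp only [Finset.mul_sum]
    rw [Finset.sum_comm]
    refine Finset.sum_congr rfl fun j _ => Finset.sum_congr rfl fun k _ => ?_
    ring
  simp only [h]
  rw [Finset.sum_comm, Finset.mul_sum]
  refine Finset.sum_congr rfl fun j _ => ?_
  rw [Finset.sum_comm]
  simp only [← Finset.sum_mul, sg_sum]
  rw [Finset.sum_eq_single j]
  · rw [if_pos rfl]; ring
  · intro k _ hk; simp [hk.symm]
  · simp

lemma four_abs (a b c : ℝ) (ha : |a| ≤ 1/2) (hb : |b| ≤ 1/2) (hc : |c| ≤ 1/2)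
    (h : |a| + |b| + |c| ≤ 1) :
    |a+b+c| + |-a+b+c| + |a-b+c| + |a+b-c| ≤ 2 := by
  rcases abs_cases a with h1 | h1 <;> rcases abs_cases b with h2 | h2 <;>
  rcases abs_cases c with h3 | h3 <;> rcases abs_cases (a+b+c) with h4 | h4 <;>
  rcases abs_cases (-a+b+c) with h5 | h5 <;> rcases abs_cases (a-b+c) with h6 | h6 <;>
  rcases abs_cases (a+b-c) with h7 | h7 <;> linarith

lemma exists_three (q : J → ℝ) (hq : ∀ j, 0 ≤ q j) (h1 : ∑ j, q j = 1)
    (hhalf : ∀ j, q j ≤ 1/2) :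
    ∃ (G : Finset J) (j : J), j ∉ G ∧ ∑ i ∈ G, q i ≤ 1/2 ∧
      ∑ i ∈ Finset.univ \ insert j G, q i ≤ 1/2 := by
  obtain ⟨G, hG, hmax⟩ := Finset.exists_max_image
    (Finset.univ.filter fun G : Finset J => ∑ i ∈ G, q i ≤ 1/2) (fun G => G.card)
    ⟨∅, by simp⟩
  simp only [Finset.mem_filter, Finset.mem_univ, true_and] at hG hmax
  have hne : ∃ j, j ∉ G := by
    by_contra! hc
    have : G = Finset.univ := by ext; simp [hc]
    rw [this, h1] at hG; norm_num at hG
  obtain ⟨j, hj⟩ := hne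
  refine ⟨G, j, hj, hG, ?_⟩
  have h2 : ¬ ∑ i ∈ insert j G, q i ≤ 1/2 := by
    intro hc
    have := hmax _ hc
    rw [Finset.card_insert_of_notMem hj] at this
    omega
  have h3 := Finset.sum_sdiff (Finset.subset_univ (insert j G)) (f := q)
  linarith

lemma sum_abs_sg (q : J → ℝ) (hq : ∀ j, 0 ≤ q j) (h1 : ∑ j, q j = 1)
    (hhalf : ∀ j, q j ≤ 1/2) :
    ∑ s : J → ℤˣ, |sg s ⬝ᵥ q| ≤ (Fintype.card (J → ℤˣ) : ℝ) / 2 := by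
  obtain ⟨G, j, hj, hG, hG'⟩ := exists_three q hq h1 hhalf
  set K := Finset.univ \ insert j G with hK
  have split : ∀ F : J → ℝ, ∑ i, F i = ∑ i ∈ G, F i + F j + ∑ i ∈ K, F i := by
    intro F
    have h3 := Finset.sum_sdiff (Finset.subset_univ (insert j G)) (f := F)
    rw [Finset.sum_insert hj] at h3
    rw [← h3]; ring
  have jK : j ∉ K := by simp [hK]
  have GK : ∀ i ∈ K, i ∉ G := by intro i hi; simp [hK] at hi; tauto
  have nej : ∀ i ∈ G, i ≠ j := by rintro i hi rfl; exact hj hi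
  let fl : Finset J → (J → ℤˣ) := fun S i => if i ∈ S then -1 else 1
  have hfl : ∀ S s i, sg (fl S * s) i = (if i ∈ S then - sg s i else sg s i) := by
    intro S s i
    rw [sg_mul]; by_cases h : i ∈ S <;> simp [sg, fl, h]
  have inv : ∀ S, ∑ s : J → ℤˣ, |sg (fl S * s) ⬝ᵥ q| = ∑ s : J → ℤˣ, |sg s ⬝ᵥ q| :=
    fun S => Equiv.sum_comp (Equiv.mulLeft (fl S)) (fun s => |sg s ⬝ᵥ q|)
  have pt : ∀ s : J → ℤˣ, |sg s ⬝ᵥ q| + |sg (fl G * s) ⬝ᵥ q| + |sg (fl {j} * s) ⬝ᵥ q|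
      + |sg (fl K * s) ⬝ᵥ q| ≤ 2 := by
    intro s
    have bd : ∀ S : Finset J, |∑ i ∈ S, sg s i * q i| ≤ ∑ i ∈ S, q i := by
      intro S
      refine (Finset.abs_sum_le_sum_abs _ _).trans (Finset.sum_le_sum fun i _ => ?_)
      rw [abs_mul, abs_of_nonneg (hq i)]
      rcases sg_cases s i with h | h <;> simp [h]
    have bj : |sg s j * q j| ≤ q j := by simpa using bd {j}
    have e0 := split (fun i => sg s i * q i)
    have e1 := split (fun i => sg (fl G * s) i * q i)
    have e2 := split (fun i => sg (fl {j} * s) i * q i)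
    have e3 := split (fun i => sg (fl K * s) i * q i)
    simp only [hfl] at e1 e2 e3
    have a1 : ∑ i ∈ G, (if i ∈ G then - sg s i else sg s i) * q i = - ∑ i ∈ G, sg s i * q i := by
      rw [← Finset.sum_neg_distrib]; exact Finset.sum_congr rfl fun i hi => by simp [hi]
    have a2 : ∑ i ∈ K, (if i ∈ G then - sg s i else sg s i) * q i = ∑ i ∈ K, sg s i * q i :=
      Finset.sum_congr rfl fun i hi => by simp [GK i hi]
    have a3 : ∑ i ∈ G, (if i ∈ ({j} : Finset J) then - sg s i else sg s i) * q i
        = ∑ i ∈ G, sg s i * q i :=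
      Finset.sum_congr rfl fun i hi => by simp [nej i hi]
    have a4 : ∑ i ∈ K, (if i ∈ ({j} : Finset J) then - sg s i else sg s i) * q i
        = ∑ i ∈ K, sg s i * q i :=
      Finset.sum_congr rfl fun i hi => by
        have : i ≠ j := by rintro rfl; exact jK hi
        simp [this]
    have a5 : ∑ i ∈ G, (if i ∈ K then - sg s i else sg s i) * q i = ∑ i ∈ G, sg s i * q i :=
      Finset.sum_congr rfl fun i hi => by
        have : i ∉ K := fun h => GK i h hi
        simp [this]
    have a6 : ∑ i ∈ K, (if i ∈ K then - sg s i else sg s i) * q i = - ∑ i ∈ K, sg s i * q i := by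
      rw [← Finset.sum_neg_distrib]; exact Finset.sum_congr rfl fun i hi => by simp [hi]
    rw [a1, a2] at e1
    rw [a3, a4] at e2
    rw [a5, a6] at e3
    simp only [hj, jK, if_false, Finset.mem_singleton, if_true] at e1 e2 e3
    have f := four_abs _ _ _ ((bd G).trans hG) (bj.trans (hhalf j)) ((bd K).trans hG')
      (by linarith [bd G, bd K, split q])
    simp only [dotProduct, hfl]
    simp only [Finset.mem_singleton] at e2 ⊢
    rw [e0, e1, e2, e3]
    have z1 : ∀ x y z : ℝ, x + -z * y = x - z * y := fun x y z => by ring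
    rw [z1, ← sub_eq_add_neg]
    exact f
  have tot := Finset.sum_le_sum (fun s (_ : s ∈ (Finset.univ : Finset (J → ℤˣ))) => pt s)
  simp only [Finset.sum_add_distrib, inv, Finset.sum_const, Finset.card_univ, nsmul_eq_mul] at tot
  linarith

/-- the abstract finite-dimensional statement -/
lemma abstract_bound (B : (J → ℝ) →ₗ[ℝ] (J → ℝ) →ₗ[ℝ] ℝ) (q : J → ℝ) (hq : ∀ j, 0 ≤ q j)
    (h1 : ∑ j, q j = 1) (c : ℝ) (hc : 0 ≤ c) (hB1 : ∀ b, B 1 b = 0)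
    (hB : ∀ a w : J → ℝ, (∀ j, 0 ≤ a j) → (∀ j, a j ≤ 1) → (∀ j, 0 ≤ w j) →
      (∀ j, w j ≤ 2 * (w ⬝ᵥ q)) → |B a w| ≤ c * (w ⬝ᵥ q)) :
    ∑ j, B (Pi.single j 1) (Pi.single j 1) ≤ 3 * c := by
  have hcard : (0:ℝ) < Fintype.card (J → ℤˣ) := by exact_mod_cast Fintype.card_pos
  have hone : (1 : J → ℝ) ⬝ᵥ q = 1 := by simpa [dotProduct] using h1
  by_cases hhalf : ∀ j, q j ≤ 1/2
  · have key : ∀ a p n : J → ℝ, (∀ j, 0 ≤ a j) → (∀ j, a j ≤ 1) → (∀ j, 0 ≤ p j) →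
        (∀ j, 0 ≤ n j) → p + n = 1 → 1/2 ≤ p ⬝ᵥ q → |B a (p - n)| ≤ c * (2 * (p ⬝ᵥ q)) := by
      intro a p n ha ha' hp hn hpn hm
      have hsum : p ⬝ᵥ q + n ⬝ᵥ q = 1 := by rw [← add_dotProduct, hpn, hone]
      have hpn' : ∀ j, p j + n j = 1 := fun j => by simpa using congrFun hpn j
      set m := p ⬝ᵥ q with hm'
      set l := (m - 1/2) / m with hl
      have hlm : l * m = m - 1/2 := by rw [hl]; field_simp
      have hl0 : 0 ≤ l := by apply div_nonneg <;> linarith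
      have hl1 : l ≤ 1 := by rw [hl, div_le_one (by linarith)]; linarith
      have b1 := hB a p ha ha' hp (fun j => by linarith [hpn' j, hn j])
      have mw : (n + l • p) ⬝ᵥ q = 1/2 := by
        rw [add_dotProduct, smul_dotProduct, smul_eq_mul, ← hm', hlm]; linarith
      have b2 := hB a (n + l • p) ha ha'
        (fun j => by simp; exact add_nonneg (hn j) (mul_nonneg hl0 (hp j)))
        (fun j => by
          rw [mw]; simp
          have := mul_le_mul_of_nonneg_right hl1 (hp j)
          linarith [hpn' j])
      rw [mw] at b2
      have e : B a (p - n) = (1 + l) * B a p - B a (n + l • p) := by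
        simp only [map_sub, map_add, map_smul, smul_eq_mul]; ring
      rw [e]
      calc _ ≤ |(1 + l) * B a p| + |B a (n + l • p)| := abs_sub _ _
        _ ≤ (1 + l) * (c * m) + c * (1/2) := by
          rw [abs_mul, abs_of_nonneg (by linarith : (0:ℝ) ≤ 1 + l)]
          gcongr
        _ = c * (2 * m) := by
          have : (1 + l) * (c * m) = c * (m + l * m) := by ring
          rw [this, hlm]; ring
    have pt : ∀ s : J → ℤˣ, B (1 * sg s) (1 * sg s) ≤ 2 * c * (1 + |sg s ⬝ᵥ q|) := by
      intro s
      rw [one_mul]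
      set p : J → ℝ := fun j => (1 + sg s j) / 2 with hp
      set n : J → ℝ := fun j => (1 - sg s j) / 2 with hn
      have hs : sg s = p - n := by ext j; simp [p, n]; ring
      have hpn : p + n = 1 := by ext j; simp [p, n]; ring
      have p0 : ∀ j, 0 ≤ p j := fun j => by rcases sg_cases s j with h | h <;> simp [p, h]
      have n0 : ∀ j, 0 ≤ n j := fun j => by rcases sg_cases s j with h | h <;> simp [n, h]
      have p1 : ∀ j, p j ≤ 1 := fun j => by rcases sg_cases s j with h | h <;> simp [p, h]
      have hsum : p ⬝ᵥ q + n ⬝ᵥ q = 1 := by rw [← add_dotProduct, hpn, hone]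
      have e : B (sg s) (sg s) = 2 * B p (p - n) := by
        have : sg s = (2:ℝ) • p - 1 := by ext j; simp [p]; ring
        rw [← hs]
        calc B (sg s) (sg s) = B ((2:ℝ) • p - 1) (sg s) := by rw [← this]
          _ = 2 * B p (sg s) := by
            rw [map_sub, LinearMap.sub_apply, hB1, map_smul, LinearMap.smul_apply]
            simp
      have f : |B p (p - n)| ≤ c * (1 + |sg s ⬝ᵥ q|) := by
        rw [hs, sub_dotProduct]
        rcases le_total (1/2) (p ⬝ᵥ q) with h | h
        · refine (key p p n p0 p1 p0 n0 hpn h).trans ?_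
          gcongr
          have := le_abs_self (p ⬝ᵥ q - n ⬝ᵥ q)
          linarith
        · have := key p n p p0 p1 n0 p0 (by rw [add_comm, hpn]) (by linarith)
          rw [← neg_sub n p, map_neg, abs_neg]
          refine this.trans ?_
          gcongr
          have := neg_le_abs (p ⬝ᵥ q - n ⬝ᵥ q)
          linarith
      rw [e]
      have := (le_abs_self _).trans f
      linarith
    have tot := Finset.sum_le_sum (fun s (_ : s ∈ (Finset.univ : Finset (J → ℤˣ))) => pt s)
    rw [sg_avg, ← Finset.mul_sum, Finset.sum_add_distrib] at tot
    simp only [Pi.one_apply, one_pow, one_mul, Finset.sum_const, Finset.card_univ, nsmul_eq_mul,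
      mul_one] at tot
    have h3 := sum_abs_sg q hq h1 hhalf
    refine le_of_mul_le_mul_left ?_ hcard
    refine tot.trans ?_
    have := mul_le_mul_of_nonneg_left h3 (by linarith : 0 ≤ 2 * c)
    linarith
  · push Not at hhalf
    obtain ⟨j0, hj0⟩ := hhalf
    set Q := q j0 with hQ
    have hQ1 : Q ≤ 1 := by
      rw [← h1]; exact Finset.single_le_sum (fun i _ => hq i) (Finset.mem_univ j0)
    set e : J → ℝ := Pi.single j0 1 with he
    have e0 : ∀ j, 0 ≤ e j := fun j => by by_cases h : j = j0 <;> simp [e, Pi.single_apply, h]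
    have e1 : ∀ j, e j ≤ 1 := fun j => by by_cases h : j = j0 <;> simp [e, Pi.single_apply, h]
    have eq' : e ⬝ᵥ q = Q := by simp [e, hQ]
    have bee := hB e e e0 e1 e0 (fun j => by rw [eq']; linarith [e1 j])
    rw [eq'] at bee
    set ν := (1 - Q) / Q with hν
    have hνQ : ν * Q = 1 - Q := by rw [hν]; field_simp
    have hν0 : 0 ≤ ν := by apply div_nonneg <;> linarith
    have hν1 : ν ≤ 1 := by rw [hν, div_le_one (by linarith)]; linarith
    have key : ∀ u v : J → ℝ, (∀ j, 0 ≤ u j) → (∀ j, 0 ≤ v j) → u + v + e = 1 →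
        B u (u - v - ν • e) ≤ c * (2 * (1 - Q) + 1 - 2 * (u ⬝ᵥ q)) := by
      intro u v hu hv huv
      have huv' : ∀ j, u j + v j + e j = 1 := fun j => by simpa using congrFun huv j
      have hsum : u ⬝ᵥ q + v ⬝ᵥ q + Q = 1 := by
        rw [← eq', ← add_dotProduct, ← add_dotProduct, huv, hone]
      have u1 : ∀ j, u j ≤ 1 := fun j => by linarith [huv' j, hv j, e0 j]
      have uq : 0 ≤ u ⬝ᵥ q := Finset.sum_nonneg fun j _ => mul_nonneg (hu j) (hq j)
      have vq : 0 ≤ v ⬝ᵥ q := Finset.sum_nonneg fun j _ => mul_nonneg (hv j) (hq j)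
      set m := u ⬝ᵥ q with hm
      set l := (1/2 - m) / Q with hl
      have hlQ : l * Q = 1/2 - m := by rw [hl]; field_simp
      have hl0 : 0 ≤ l := by apply div_nonneg <;> linarith
      have hl1 : l ≤ 1 := by rw [hl, div_le_one (by linarith)]; linarith
      have ej : ∀ j, (e j = 0) ∨ (e j = 1 ∧ u j = 0 ∧ v j = 0) := by
        intro j
        by_cases h : j = j0
        · right
          have : e j = 1 := by simp [e, h]
          have := huv' j
          refine ⟨by assumption, ?_, ?_⟩ <;> linarith [hu j, hv j]
        · left; simp [e, h]
      have m1 : (u + l • e) ⬝ᵥ q = 1/2 := by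
        rw [add_dotProduct, smul_dotProduct, smul_eq_mul, eq', hlQ, ← hm]; ring
      have m2 : (v + (ν + l) • e) ⬝ᵥ q = v ⬝ᵥ q + (ν + l) * Q := by
        rw [add_dotProduct, smul_dotProduct, smul_eq_mul, eq']
      have b1 := hB u (u + l • e) hu u1
        (fun j => by simp; exact add_nonneg (hu j) (mul_nonneg hl0 (e0 j)))
        (fun j => by
          rw [m1]; simp
          rcases ej j with h | ⟨h, h', h''⟩
          · simp [h, u1 j]
          · simp [h, h', hl1])
      have b2 := hB u (v + (ν + l) • e) hu u1
        (fun j => by simp; exact add_nonneg (hv j) (mul_nonneg (add_nonneg hν0 hl0) (e0 j)))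
        (fun j => by
          rw [m2]; simp
          rcases ej j with h | ⟨h, h', h''⟩
          · simp only [h, mul_zero, add_zero]
            have : v j ≤ 1 := by linarith [huv' j, hu j, e0 j]
            rw [add_mul, hνQ, hlQ]; linarith
          · simp only [h, h'', mul_one, zero_add]
            have : (ν + l) * 1 ≤ (ν + l) * (2 * Q) := by
              apply mul_le_mul_of_nonneg_left <;> linarith
            linarith)
      rw [m1] at b1
      rw [m2, add_mul, hνQ, hlQ] at b2
      have ee : B u (u - v - ν • e) = B u (u + l • e) - B u (v + (ν + l) • e) := by
        simp only [map_sub, map_add, map_smul, smul_eq_mul]; ring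
      rw [ee]
      have x1 := le_abs_self (B u (u + l • e))
      have x2 := neg_abs_le (B u (v + (ν + l) • e))
      have : c * (2 * (1 - Q) + 1 - 2 * m) = c * (1/2) + c * (v ⬝ᵥ q + (1 - Q + (1/2 - m))) := by
        have : v ⬝ᵥ q = 1 - Q - m := by linarith
        rw [this]; ring
      rw [this]; linarith
    set d : J → ℝ := 1 - e with hd
    have pt : ∀ s : J → ℤˣ, B (d * sg s) (d * sg s) + B e e ≤ 3 * c := by
      intro s
      set u : J → ℝ := fun j => d j * ((1 + sg s j) / 2) with hu
      set v : J → ℝ := fun j => d j * ((1 - sg s j) / 2) with hv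
      have d0 : ∀ j, 0 ≤ d j := fun j => by simp [d, e1 j]
      have hs : d * sg s = u - v := by ext j; simp [u, v]; ring
      have huv : u + v + e = 1 := by ext j; simp [u, v, d]; ring
      have u0 : ∀ j, 0 ≤ u j := fun j => by
        rcases sg_cases s j with h | h <;> simp [u, h, d0]
      have v0 : ∀ j, 0 ≤ v j := fun j => by
        rcases sg_cases s j with h | h <;> simp [v, h, d0]
      have hsum : u ⬝ᵥ q + v ⬝ᵥ q + Q = 1 := by
        rw [← eq', ← add_dotProduct, ← add_dotProduct, huv, hone]
      have k1 := key u v u0 v0 huv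
      have k2 := key v u v0 u0 (by rw [← huv]; abel)
      have z : B u e + B v e + B e e = 0 := by
        have := hB1 e
        rw [← huv] at this
        simpa only [map_add, LinearMap.add_apply] using this
      have ee : B (u - v) (u - v) + B e e
          = (1 - ν) * B e e + B u (u - v - ν • e) + B v (v - u - ν • e) := by
        simp only [map_sub, LinearMap.sub_apply, map_smul, smul_eq_mul]
        linear_combination ν * z
      rw [hs, ee]
      have x1 : (1 - ν) * B e e ≤ (1 - ν) * (c * Q) :=
        mul_le_mul_of_nonneg_left ((le_abs_self _).trans bee) (by linarith)
      have x2 : (1 - ν) * (c * Q) = c * (Q - ν * Q) := by ring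
      rw [x2, hνQ] at x1
      have x3 : v ⬝ᵥ q = 1 - Q - u ⬝ᵥ q := by linarith
      rw [x3] at k2
      linarith
    have tot := Finset.sum_le_sum (fun s (_ : s ∈ (Finset.univ : Finset (J → ℤˣ))) => pt s)
    rw [Finset.sum_add_distrib, sg_avg] at tot
    simp only [Finset.sum_const, Finset.card_univ, nsmul_eq_mul] at tot
    rw [← mul_add] at tot
    have t2 := le_of_mul_le_mul_left tot hcard
    refine le_trans (le_of_eq ?_) t2
    rw [← Finset.add_sum_erase _ _ (Finset.mem_univ j0),
      ← Finset.add_sum_erase _ (fun j => d j ^ 2 * _) (Finset.mem_univ j0)]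
    have : d j0 = 0 := by simp [d, e]
    rw [this, add_comm]
    have : ∑ j ∈ Finset.univ.erase j0, B (Pi.single j 1) (Pi.single j 1)
        = ∑ j ∈ Finset.univ.erase j0, d j ^ 2 * B (Pi.single j 1) (Pi.single j 1) :=
      Finset.sum_congr rfl fun j hj => by
        have : d j = 1 := by simp [d, e, Finset.ne_of_mem_erase hj]
        rw [this]; ring
    rw [this]; simp [e]

end Abs

section Mat
set_option linter.unusedSectionVars false

lemma trace_mul_psd {n : Type*} [Fintype n] [DecidableEq n] {P Q : Matrix n n ℂ}
    (hP : P.PosSemidef) (hQ : Q.PosSemidef) : 0 ≤ (P * Q).trace.re := by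
  open scoped MatrixOrder in
  obtain ⟨C, rfl⟩ := CStarAlgebra.nonneg_iff_eq_star_mul_self.mp
    (Matrix.nonneg_iff_posSemidef.mpr hP)
  rw [Matrix.star_eq_conjTranspose, Matrix.mul_assoc, Matrix.trace_mul_comm]
  have := (hQ.mul_mul_conjTranspose_same C).trace_nonneg
  exact (Complex.nonneg_iff.mp this).1

lemma sqrt_psd {n : Type*} [Fintype n] [DecidableEq n] {M : Matrix n n ℂ}
    (hM : M.PosSemidef) : hM.sqrt.PosSemidef := by
  unfold Matrix.PosSemidef.sqrt
  have : (diagonal ((↑) ∘ Real.sqrt ∘ hM.1.eigenvalues) : Matrix n n ℂ).PosSemidef := by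
    apply Matrix.PosSemidef.diagonal
    intro i
    simp
  exact this.mul_mul_conjTranspose_same _

lemma sqrt_mul_sqrt {n : Type*} [Fintype n] [DecidableEq n] {M : Matrix n n ℂ}
    (hM : M.PosSemidef) : hM.sqrt * hM.sqrt = M := by
  unfold Matrix.PosSemidef.sqrt
  set U := hM.1.eigenvectorUnitary
  have h1 : (star U : Matrix n n ℂ) * U.1 = 1 := Unitary.coe_star_mul_self U
  have h2 : (diagonal ((↑) ∘ Real.sqrt ∘ hM.1.eigenvalues) : Matrix n n ℂ)
      * diagonal ((↑) ∘ Real.sqrt ∘ hM.1.eigenvalues)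
      = diagonal ((↑) ∘ hM.1.eigenvalues) := by
    rw [diagonal_mul_diagonal]
    congr 1; ext i
    simp only [Function.comp]
    have := Real.mul_self_sqrt (hM.eigenvalues_nonneg i)
    exact_mod_cast congrArg (fun x : ℝ => (x : ℂ)) this
  have h3 := hM.1.spectral_theorem
  rw [Unitary.conjStarAlgAut_apply] at h3
  conv_rhs => rw [h3]
  calc _ = U.1 * diagonal ((↑) ∘ Real.sqrt ∘ hM.1.eigenvalues) * ((star U : Matrix n n ℂ) * U.1)
      * diagonal ((↑) ∘ Real.sqrt ∘ hM.1.eigenvalues) * (star U : Matrix n n ℂ) := by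
        simp only [Matrix.mul_assoc]; rfl
    _ = U.1 * (diagonal ((↑) ∘ Real.sqrt ∘ hM.1.eigenvalues)
      * diagonal ((↑) ∘ Real.sqrt ∘ hM.1.eigenvalues)) * (star U : Matrix n n ℂ) := by
        rw [h1]; simp only [Matrix.mul_assoc, Matrix.one_mul]
    _ = _ := by rw [h2]; rfl

open scoped MatrixOrder Matrix.Norms.L2Operator in
lemma jordan {n : Type*} [Fintype n] [DecidableEq n] {H : Matrix n n ℂ} (hH : H.IsHermitian) :
    ∃ P Q : Matrix n n ℂ, P.PosSemidef ∧ Q.PosSemidef ∧ H = P - Q ∧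
      P.trace.re + Q.trace.re = traceNorm H := by
  have hs : IsSelfAdjoint H := hH
  refine ⟨H⁺, H⁻, Matrix.nonneg_iff_posSemidef.mp (CFC.posPart_nonneg H),
    Matrix.nonneg_iff_posSemidef.mp (CFC.negPart_nonneg H), (CFC.posPart_sub_negPart H).symm, ?_⟩
  rw [← Complex.add_re, ← Matrix.trace_add, CFC.posPart_add_negPart H]
  unfold traceNorm
  have : CFC.abs H = (Matrix.posSemidef_conjTranspose_mul_self H).sqrt :=
    CFC.sqrt_unique (sqrt_mul_sqrt _) (Matrix.nonneg_iff_posSemidef.mpr (sqrt_psd _))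
  rw [this]

lemma half_bound {n : Type*} [Fintype n] [DecidableEq n] {P Q A : Matrix n n ℂ}
    (hP : P.PosSemidef) (hQ : Q.PosSemidef) (hPQ : P.trace.re = Q.trace.re)
    (hA : A.PosSemidef) (hA1 : (1 - A).PosSemidef) :
    |(A * (P - Q)).trace.re| ≤ P.trace.re := by
  have a1 := trace_mul_psd hA hP
  have a2 := trace_mul_psd hA hQ
  have a3 := trace_mul_psd hA1 hP
  have a4 := trace_mul_psd hA1 hQ
  simp only [Matrix.sub_mul, Matrix.one_mul, Matrix.trace_sub, Complex.sub_re] at a3 a4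
  rw [Matrix.mul_sub, Matrix.trace_sub, Complex.sub_re, abs_le]
  constructor <;> linarith

variable {a e b : Type*} [Fintype a] [Fintype e] [Fintype b]

lemma ptraceE_psd {M : Matrix (a × e) (a × e) ℂ} (hM : M.PosSemidef) :
    (ptraceE M).PosSemidef := by
  have : ptraceE M = ∑ x : e, M.submatrix (fun i => (i, x)) (fun i => (i, x)) := by
    ext i j; simp [ptraceE, Matrix.sum_apply]
  rw [this]
  exact Matrix.posSemidef_sum _ fun x _ => hM.submatrix _

lemma ptraceA_psd {M : Matrix (a × e) (a × e) ℂ} (hM : M.PosSemidef) :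
    (ptraceA M).PosSemidef := by
  have : ptraceA M = ∑ x : a, M.submatrix (fun i => (x, i)) (fun i => (x, i)) := by
    ext i j; simp [ptraceA, Matrix.sum_apply]
  rw [this]
  exact Matrix.posSemidef_sum _ fun x _ => hM.submatrix _

lemma ptraceE_trace (M : Matrix (a × e) (a × e) ℂ) : (ptraceE M).trace = M.trace := by
  simp [ptraceE, Matrix.trace, Fintype.sum_prod_type]

lemma ptraceA_trace (M : Matrix (a × e) (a × e) ℂ) : (ptraceA M).trace = M.trace := by
  simp [ptraceA, Matrix.trace, Fintype.sum_prod_type]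
  rw [Finset.sum_comm]

lemma ptraceE_sub (M M' : Matrix (a × e) (a × e) ℂ) :
    ptraceE (M - M') = ptraceE M - ptraceE M' := by
  ext i j; simp [ptraceE]

lemma ptraceE_sum {ι : Type*} [Fintype ι] (M : ι → Matrix (a × e) (a × e) ℂ) :
    ptraceE (∑ i, M i) = ∑ i, ptraceE (M i) := by
  ext i j; simp only [ptraceE, Matrix.of_apply, Matrix.sum_apply]; rw [Finset.sum_comm]

lemma my_sub_kron (X X' : Matrix a a ℂ) (Y : Matrix e e ℂ) :
    (X - X') ⊗ₖ Y = X ⊗ₖ Y - X' ⊗ₖ Y := by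
  ext i j; simp [sub_mul]

lemma ptraceE_kron (X : Matrix a a ℂ) (Y : Matrix e e ℂ) :
    ptraceE (X ⊗ₖ Y) = Y.trace • X := by
  ext i j; simp [ptraceE, Matrix.trace, ← Finset.mul_sum, mul_comm]

lemma ptraceE_conj [DecidableEq e] (K : Matrix b a ℂ) (M : Matrix (a × e) (a × e) ℂ) :
    ptraceE ((K ⊗ₖ (1 : Matrix e e ℂ)) * M * (K ⊗ₖ (1 : Matrix e e ℂ))ᴴ)
      = K * ptraceE M * Kᴴ := by
  ext i j
  simp only [ptraceE, Matrix.of_apply, Matrix.mul_apply, Matrix.conjTranspose_apply,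
    Matrix.kroneckerMap_apply, Fintype.sum_prod_type, Matrix.one_apply, mul_ite, mul_one, mul_zero,
    ite_mul, zero_mul, Finset.sum_ite_eq, Finset.mem_univ, if_true, apply_ite star, star_zero]
  simp only [Finset.sum_mul, Finset.mul_sum]
  rw [Finset.sum_comm]
  refine Finset.sum_congr rfl fun x _ => ?_
  rw [Finset.sum_comm]

/-- the "encryption error" map -/
def Phi {ι : Type*} [Fintype ι] [DecidableEq e] (N : ι → Matrix b a ℂ) (Ω : Matrix b b ℂ) :
    Matrix (a × e) (a × e) ℂ →ₗ[ℂ] Matrix (b × e) (b × e) ℂ where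
  toFun M := (∑ j, (N j ⊗ₖ (1 : Matrix e e ℂ)) * M * (N j ⊗ₖ (1 : Matrix e e ℂ))ᴴ)
    - Ω ⊗ₖ ptraceA M
  map_add' M M' := by
    have : ptraceA (M + M') = ptraceA M + ptraceA M' := by
      ext i j; simp [ptraceA, Finset.sum_add_distrib]
    rw [this, Matrix.kronecker_add]
    simp only [Matrix.mul_add, Matrix.add_mul, Finset.sum_add_distrib]
    abel
  map_smul' c M := by
    have : ptraceA (c • M) = c • ptraceA M := by
      ext i j; simp [ptraceA, Finset.mul_sum]
    rw [this, Matrix.kronecker_smul]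
    simp only [Matrix.mul_smul, Matrix.smul_mul, ← Finset.smul_sum, RingHom.id_apply, smul_sub]

variable [DecidableEq a] [DecidableEq e] [DecidableEq b] {ι : Type*} [Fintype ι]

lemma Phi_trace (N : ι → Matrix b a ℂ) (hN : ∑ j, (N j)ᴴ * N j = 1) (Ω : Matrix b b ℂ)
    (hΩ : IsDensity Ω) (M : Matrix (a × e) (a × e) ℂ) : (Phi N Ω M).trace = 0 := by
  change ((∑ j, (N j ⊗ₖ (1 : Matrix e e ℂ)) * M * (N j ⊗ₖ (1 : Matrix e e ℂ))ᴴ)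
    - Ω ⊗ₖ ptraceA M).trace = 0
  rw [Matrix.trace_sub, Matrix.trace_kronecker, hΩ.2, one_mul, ptraceA_trace, Matrix.trace_sum]
  have h : ∀ j, ((N j ⊗ₖ (1 : Matrix e e ℂ)) * M * (N j ⊗ₖ (1 : Matrix e e ℂ))ᴴ).trace
      = ((((N j)ᴴ * N j) ⊗ₖ (1 : Matrix e e ℂ)) * M).trace := by
    intro j
    rw [Matrix.trace_mul_comm, ← Matrix.mul_assoc, Matrix.conjTranspose_kronecker,
      ← Matrix.mul_kronecker_mul]
    simp
  simp only [h]
  rw [← Matrix.trace_sum, ← Finset.sum_mul]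
  have : ∑ j, ((N j)ᴴ * N j) ⊗ₖ (1 : Matrix e e ℂ) = (∑ j, (N j)ᴴ * N j) ⊗ₖ (1 : Matrix e e ℂ) := by
    ext i j; simp [Matrix.sum_apply, Finset.sum_mul]
  rw [this, hN]; simp

lemma Phi_herm (N : ι → Matrix b a ℂ) (Ω : Matrix b b ℂ)
    (hΩ : IsDensity Ω) (M : Matrix (a × e) (a × e) ℂ) (hM : M.PosSemidef) :
    (Phi N Ω M).IsHermitian := by
  refine Matrix.IsHermitian.sub
    (Matrix.posSemidef_sum Finset.univ fun j _ => hM.mul_mul_conjTranspose_same _).1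
    (hΩ.1.kronecker (ptraceA_psd hM)).1

end Mat

/-- entropic indistinguishability implies strong entropic security.
If there is a density `Ω` with `‖(E ⊗ id)(ρ') - Ω ⊗ tr_A ρ'‖₁ ≤ ε/2` for every
density `ρ'` with `ρ' ≤ 2^{-(t-1)}(I ⊗ σ')` for some density `σ'`, then for
every density `ρ` with `ρ ≤ 2^{-t}(I ⊗ σ)` for some density `σ`, every
interpretation `∑ᵢ pᵢ σᵢ = ρ`, every POVM `(A_j)` and every function `f`,
`|∑ᵢ pᵢ tr[A_{f(i)} (E ⊗ id)(σᵢ)] - ∑ᵢ pᵢ tr[A_{f(i)} (E(tr_E ρ) ⊗ tr_A σᵢ)]| ≤ ε`. -/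
theorem indistinguishability_implies_strong_entropic_security
    {dA dE d' : ℕ} {J0 : Type*} [Fintype J0]
    (N : J0 → Matrix (Fin d') (Fin dA) ℂ)
    (hN : ∑ j, (N j)ᴴ * N j = 1)
    (t ε : ℝ) (hε : 0 ≤ ε)
    (Ω : Matrix (Fin d') (Fin d') ℂ) (hΩ : IsDensity Ω)
    (hind : ∀ ρ' : Matrix (Fin dA × Fin dE) (Fin dA × Fin dE) ℂ, IsDensity ρ' →
      (∃ σ' : Matrix (Fin dE) (Fin dE) ℂ, IsDensity σ' ∧
        LoewnerLE ρ' ((((2 : ℝ) ^ (-(t - 1)) : ℝ) : ℂ) •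
          ((1 : Matrix (Fin dA) (Fin dA) ℂ) ⊗ₖ σ'))) →
      traceNorm
          ((∑ j, (N j ⊗ₖ (1 : Matrix (Fin dE) (Fin dE) ℂ)) * ρ' *
              (N j ⊗ₖ (1 : Matrix (Fin dE) (Fin dE) ℂ))ᴴ)
            - Ω ⊗ₖ ptraceA ρ')
        ≤ ε / 2)
    (ρ : Matrix (Fin dA × Fin dE) (Fin dA × Fin dE) ℂ) (hρ : IsDensity ρ)
    (hmin : ∃ σ : Matrix (Fin dE) (Fin dE) ℂ, IsDensity σ ∧
      LoewnerLE ρ ((((2 : ℝ) ^ (-t) : ℝ) : ℂ) •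
        ((1 : Matrix (Fin dA) (Fin dA) ℂ) ⊗ₖ σ)))
    {I : Type*} [Fintype I] (p : I → ℝ) (hp : ∀ i, 0 ≤ p i) (hpsum : ∑ i, p i = 1)
    (σi : I → Matrix (Fin dA × Fin dE) (Fin dA × Fin dE) ℂ)
    (hσi : ∀ i, IsDensity (σi i))
    (hinterp : ∑ i, (p i : ℂ) • σi i = ρ)
    {J : Type*} [Fintype J]
    (A : J → Matrix (Fin d' × Fin dE) (Fin d' × Fin dE) ℂ)
    (hA : ∀ j, (A j).PosSemidef) (hAsum : ∑ j, A j = 1)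
    (f : I → J) :
    |∑ i, p i *
        (Matrix.trace (A (f i) *
          (∑ j, (N j ⊗ₖ (1 : Matrix (Fin dE) (Fin dE) ℂ)) * σi i *
            (N j ⊗ₖ (1 : Matrix (Fin dE) (Fin dE) ℂ))ᴴ))).re
      - ∑ i, p i *
        (Matrix.trace (A (f i) *
          ((∑ j, N j * ptraceE ρ * (N j)ᴴ) ⊗ₖ ptraceA (σi i)))).re|
      ≤ ε := by
  classical
  obtain ⟨σ, hσ, hle⟩ := hmin
  have smulpsd : ∀ {n : Type} [Fintype n] (r : ℝ) (M : Matrix n n ℂ), 0 ≤ r → M.PosSemidef →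
      ((r : ℂ) • M).PosSemidef := fun r M hr hM =>
    hM.smul (by exact_mod_cast hr : (0:ℂ) ≤ (r : ℂ))
  -- densities below 2ρ
  have core : ∀ τ : Matrix (Fin dA × Fin dE) (Fin dA × Fin dE) ℂ, IsDensity τ →
      (((2:ℝ) : ℂ) • ρ - τ).PosSemidef → ∃ P Q, P.PosSemidef ∧ Q.PosSemidef ∧
        Phi N Ω τ = P - Q ∧ P.trace.re = Q.trace.re ∧ P.trace.re ≤ ε / 4 := by
    intro τ hτ hτρ
    have h1 := hind τ hτ ⟨σ, hσ, by
      unfold LoewnerLE at hle ⊢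
      have h2 : (2:ℝ) ^ (-(t - 1)) = 2 * (2:ℝ) ^ (-t) := by
        rw [show -(t - 1) = 1 + -t by ring, Real.rpow_add (by norm_num), Real.rpow_one]
      have := (smulpsd 2 _ (by norm_num) hle).add hτρ
      convert this using 1
      rw [h2, smul_sub, smul_smul]
      push_cast
      abel⟩
    obtain ⟨P, Q, hP, hQ, hPQ, htr⟩ := jordan (Phi_herm N Ω hΩ τ hτ.1)
    have h0 := Phi_trace N hN Ω hΩ τ
    have h3 : P.trace.re = Q.trace.re := by
      rw [hPQ, Matrix.trace_sub] at h0
      have := congrArg Complex.re h0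
      simp at this; linarith
    refine ⟨P, Q, hP, hQ, hPQ, h3, ?_⟩
    have : traceNorm (Phi N Ω τ) ≤ ε / 2 := h1
    linarith
  have core2 : ∀ (C : Matrix (Fin d' × Fin dE) (Fin d' × Fin dE) ℂ)
      (τ : Matrix (Fin dA × Fin dE) (Fin dA × Fin dE) ℂ) (m : ℝ),
      C.PosSemidef → (1 - C).PosSemidef → τ.PosSemidef → τ.trace = (m : ℂ) →
      (((2 * m : ℝ) : ℂ) • ρ - τ).PosSemidef →
      |(C * Phi N Ω τ).trace.re| ≤ ε / 4 * m := by
    intro C τ m hC hC1 hτ htr hle'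
    have hm : 0 ≤ m := by
      have := hτ.trace_nonneg
      rw [htr] at this; exact_mod_cast this
    rcases hm.eq_or_lt with h | h
    · rw [← h] at htr ⊢
      have : τ = 0 := hτ.trace_eq_zero_iff.mp (by simpa using htr)
      simp [this]
    · have hm' : (m : ℂ) ≠ 0 := by exact_mod_cast h.ne'
      obtain ⟨P, Q, hP, hQ, hPQ, h3, h4⟩ := core (((m⁻¹ : ℝ) : ℂ) • τ)
        ⟨smulpsd _ _ (inv_nonneg.mpr hm) hτ, by
          rw [Matrix.trace_smul, htr]; simp [hm']⟩
        (by
          convert smulpsd m⁻¹ _ (inv_nonneg.mpr hm) hle' using 1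
          rw [smul_sub, smul_smul]
          congr 2
          push_cast
          field_simp)
      have hb := half_bound hP hQ h3 hC hC1
      rw [← hPQ, map_smul, Matrix.mul_smul, Matrix.trace_smul, smul_eq_mul,
        Complex.re_ofReal_mul, abs_mul, abs_of_nonneg (inv_nonneg.mpr hm)] at hb
      have := hb.trans h4
      rw [inv_mul_le_iff₀ h] at this
      linarith
  -- grouping
  set q : J → ℝ := fun k => ∑ i, if f i = k then p i else 0 with hq
  set S : J → Matrix (Fin dA × Fin dE) (Fin dA × Fin dE) ℂ :=
    fun k => ∑ i, if f i = k then (p i : ℂ) • σi i else 0 with hS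
  have q0 : ∀ k, 0 ≤ q k := fun k => Finset.sum_nonneg fun i _ => by
    split_ifs; exacts [hp i, le_rfl]
  have q1 : ∑ k, q k = 1 := by
    rw [← hpsum, hq]; dsimp only; rw [Finset.sum_comm]; simp
  have Spsd : ∀ k, (S k).PosSemidef := fun k => Matrix.posSemidef_sum _ fun i _ => by
    split_ifs
    · exact smulpsd _ _ (hp i) (hσi i).1
    · exact Matrix.PosSemidef.zero
  have Str : ∀ k, (S k).trace = (q k : ℂ) := fun k => by
    simp only [hS, hq, Matrix.trace_sum]
    push_cast
    refine Finset.sum_congr rfl fun i _ => ?_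
    split_ifs <;> simp [(hσi i).2]
  have Ssum : ∑ k, S k = ρ := by
    rw [← hinterp, hS]; dsimp only; rw [Finset.sum_comm]; simp
  let B : (J → ℝ) →ₗ[ℝ] (J → ℝ) →ₗ[ℝ] ℝ := LinearMap.mk₂ ℝ
    (fun x y => ((∑ j, (x j : ℂ) • A j) * Phi N Ω (∑ k, (y k : ℂ) • S k)).trace.re)
    (by intro x x' y; simp [add_smul, Finset.sum_add_distrib, Matrix.add_mul])
    (by
      intro c x y
      simp only [Pi.smul_apply, smul_eq_mul, Complex.ofReal_mul, mul_smul, ← Finset.smul_sum,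
        Matrix.smul_mul, Matrix.trace_smul, Complex.re_ofReal_mul])
    (by intro x y y'; simp [add_smul, Finset.sum_add_distrib, Matrix.mul_add])
    (by
      intro c x y
      simp only [Pi.smul_apply, smul_eq_mul, Complex.ofReal_mul, mul_smul, ← Finset.smul_sum,
        Matrix.mul_smul, Matrix.trace_smul, Complex.re_ofReal_mul, map_smul])
  have Bdef : ∀ x y, B x y = ((∑ j, (x j : ℂ) • A j) * Phi N Ω (∑ k, (y k : ℂ) • S k)).trace.re :=
    fun x y => rfl
  have B1 : ∀ y, B 1 y = 0 := by
    intro y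
    rw [Bdef]
    simp [hAsum, Phi_trace N hN Ω hΩ]
  have Bb : ∀ x w : J → ℝ, (∀ j, 0 ≤ x j) → (∀ j, x j ≤ 1) → (∀ j, 0 ≤ w j) →
      (∀ j, w j ≤ 2 * (w ⬝ᵥ q)) → |B x w| ≤ ε / 4 * (w ⬝ᵥ q) := by
    intro x w hx hx1 hw hw1
    rw [Bdef]
    apply core2
    · exact Matrix.posSemidef_sum _ fun j _ => smulpsd _ _ (hx j) (hA j)
    · have : 1 - ∑ j, (x j : ℂ) • A j = ∑ j, ((1 - x j : ℝ) : ℂ) • A j := by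
        rw [← hAsum, ← Finset.sum_sub_distrib]
        refine Finset.sum_congr rfl fun j _ => ?_
        push_cast; rw [sub_smul, one_smul]
      rw [this]
      exact Matrix.posSemidef_sum _ fun j _ => smulpsd _ _ (by linarith [hx1 j]) (hA j)
    · exact Matrix.posSemidef_sum _ fun j _ => smulpsd _ _ (hw j) (Spsd j)
    · simp [Matrix.trace_sum, Str, dotProduct]
    · have : ((2 * (w ⬝ᵥ q) : ℝ) : ℂ) • ρ - ∑ k, (w k : ℂ) • S k
          = ∑ k, ((2 * (w ⬝ᵥ q) - w k : ℝ) : ℂ) • S k := by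
        rw [← Ssum, Finset.smul_sum, ← Finset.sum_sub_distrib]
        refine Finset.sum_congr rfl fun j _ => ?_
        rw [Complex.ofReal_sub, sub_smul]
      rw [this]
      exact Matrix.posSemidef_sum _ fun j _ => smulpsd _ _ (by linarith [hw1 j]) (Spsd j)
  have first : |∑ i, p i * (A (f i) * Phi N Ω (σi i)).trace.re| ≤ 3 * (ε / 4) := by
    have e : ∑ i, p i * (A (f i) * Phi N Ω (σi i)).trace.re
        = ∑ j, B (Pi.single j 1) (Pi.single j 1) := by
      have h : ∀ j, B (Pi.single j 1) (Pi.single j 1)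
          = ∑ i, if f i = j then p i * (A j * Phi N Ω (σi i)).trace.re else 0 := by
        intro j
        rw [Bdef]
        have s1 : ∀ F : J → Matrix (Fin d' × Fin dE) (Fin d' × Fin dE) ℂ,
            ∑ k, (((Pi.single j 1 : J → ℝ) k : ℝ) : ℂ) • F k = F j := by
          intro F
          rw [Finset.sum_eq_single j] <;> simp +contextual
        have s2 : ∀ F : J → Matrix (Fin dA × Fin dE) (Fin dA × Fin dE) ℂ,
            ∑ k, (((Pi.single j 1 : J → ℝ) k : ℝ) : ℂ) • F k = F j := by
          intro F
          rw [Finset.sum_eq_single j] <;> simp +contextual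
        rw [s1, s2, hS]
        dsimp only
        rw [map_sum, Finset.mul_sum, Matrix.trace_sum, Complex.re_sum]
        refine Finset.sum_congr rfl fun i _ => ?_
        split_ifs
        · rw [map_smul, Matrix.mul_smul, Matrix.trace_smul, smul_eq_mul, Complex.re_ofReal_mul]
        · simp
      simp only [h]
      rw [Finset.sum_comm]
      simp
    rw [e, abs_le]
    have u1 := abstract_bound B q q0 q1 (ε / 4) (by linarith) B1 Bb
    have u2 := abstract_bound (-B) q q0 q1 (ε / 4) (by linarith) (by simp [B1])
      (by
        intro x w h1 h2 h3 h4
        simpa using Bb x w h1 h2 h3 h4)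
    simp only [LinearMap.neg_apply, Finset.sum_neg_distrib] at u2
    constructor <;> linarith
  have A1 : ∀ j, (1 - A j).PosSemidef := by
    intro j
    rw [← hAsum, ← Finset.sum_erase_eq_sub (Finset.mem_univ j)]
    exact Matrix.posSemidef_sum _ fun k _ => hA k
  -- second part
  obtain ⟨P, Q, hP, hQ, hPQ, h3, h4⟩ := core ρ hρ (by
    have : ((2:ℝ) : ℂ) • ρ - ρ = ρ := by
      push_cast; rw [two_smul]; abel
    rw [this]; exact hρ.1)
  have hΔ : (∑ j, N j * ptraceE ρ * (N j)ᴴ) - Ω = ptraceE P - ptraceE Q := by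
    rw [← ptraceE_sub, ← hPQ]
    change _ = ptraceE ((∑ j, (N j ⊗ₖ (1 : Matrix (Fin dE) (Fin dE) ℂ)) * ρ *
      (N j ⊗ₖ (1 : Matrix (Fin dE) (Fin dE) ℂ))ᴴ) - Ω ⊗ₖ ptraceA ρ)
    rw [ptraceE_sub, ptraceE_sum, ptraceE_kron, ptraceA_trace, hρ.2, one_smul]
    simp only [ptraceE_conj]
  have second : ∀ i, |(A (f i) * (((∑ j, N j * ptraceE ρ * (N j)ᴴ) - Ω) ⊗ₖ
      ptraceA (σi i))).trace.re| ≤ ε / 4 := by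
    intro i
    have hs := ptraceA_psd (hσi i).1
    have tr : ∀ M : Matrix (Fin d' × Fin dE) (Fin d' × Fin dE) ℂ,
        (ptraceE M ⊗ₖ ptraceA (σi i)).trace = M.trace := by
      intro M
      rw [Matrix.trace_kronecker, ptraceE_trace, ptraceA_trace, (hσi i).2, mul_one]
    have := half_bound ((ptraceE_psd hP).kronecker hs) ((ptraceE_psd hQ).kronecker hs)
      (by rw [tr, tr, h3]) (hA (f i)) (A1 (f i))
    rw [tr, ← my_sub_kron, ← hΔ] at this
    exact this.trans h4
  have second' : |∑ i, p i * (A (f i) * (((∑ j, N j * ptraceE ρ * (N j)ᴴ) - Ω) ⊗ₖ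
      ptraceA (σi i))).trace.re| ≤ ε / 4 := by
    refine (Finset.abs_sum_le_sum_abs _ _).trans ?_
    calc _ ≤ ∑ i, p i * (ε / 4) := Finset.sum_le_sum fun i _ => by
          rw [abs_mul, abs_of_nonneg (hp i)]
          exact mul_le_mul_of_nonneg_left (second i) (hp i)
      _ = ε / 4 := by rw [← Finset.sum_mul, hpsum, one_mul]
  have split : ∀ i, p i *
        (Matrix.trace (A (f i) *
          (∑ j, (N j ⊗ₖ (1 : Matrix (Fin dE) (Fin dE) ℂ)) * σi i *
            (N j ⊗ₖ (1 : Matrix (Fin dE) (Fin dE) ℂ))ᴴ))).re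
      - p i *
        (Matrix.trace (A (f i) *
          ((∑ j, N j * ptraceE ρ * (N j)ᴴ) ⊗ₖ ptraceA (σi i)))).re
      = p i * (A (f i) * Phi N Ω (σi i)).trace.re
        - p i * (A (f i) * (((∑ j, N j * ptraceE ρ * (N j)ᴴ) - Ω) ⊗ₖ
      ptraceA (σi i))).trace.re := by
    intro i
    change _ = p i * (A (f i) * ((∑ j, (N j ⊗ₖ (1 : Matrix (Fin dE) (Fin dE) ℂ)) * σi i *
      (N j ⊗ₖ (1 : Matrix (Fin dE) (Fin dE) ℂ))ᴴ) - Ω ⊗ₖ ptraceA (σi i))).trace.re - _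
    rw [my_sub_kron, Matrix.mul_sub, Matrix.mul_sub, Matrix.trace_sub, Matrix.trace_sub,
      Complex.sub_re, Complex.sub_re]
    ring
  rw [← Finset.sum_sub_distrib]
  simp only [split]
  rw [Finset.sum_sub_distrib]
  refine (abs_sub _ _).trans ?_
  linarith
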